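/- arXiv:2504.21708 — 6 statements merged into one kernel-verified Lean document; each statement's English description precedes it below -/
import Mathlib

section
/- Let K be a field, P = (p_1, ..., p_n) polynomials in K[x_1, ..., x_n, u_1, ..., u_m], t ≥ 1 an integer, and w = (w_1, ..., w_n) a vector of power series in K[[u_1, ..., u_m]] such that the determinant of the Jacobian matrix Jac(P)(w, u) is a unit in K[[u_1, ..., u_m]] and p_i(w, u) ∈ m^t for all i, where m is the ideal of K[[u_1,...,u_m]] generated by u_1, ..., u_m. Define w' = w − Jac(P)(w, u)^{-1} · (p_1(w, u), ..., p_n(w, u))^T, using the matrix inverse over K[[u_1,...,u_m]]. Then: (i) w'_j − w_j ∈ m^t for every j; (ii) p_i(w', u) ∈ m^{2t} for every i; and (iii) the determinant of Jac(P)(w', u) is a unit in K[[u_1, ..., u_m]]. -/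
open MvPolynomial

/-- Evaluation of a polynomial in `K[x_1,...,x_n,u_1,...,u_m]` at a vector `w` of
power series (for the `x` variables) and the power series variables `u`. -/
noncomputable def evalAt {K : Type*} [Field K] {n m : ℕ}
    (w : Fin n → MvPowerSeries (Fin m) K) :
    MvPolynomial (Fin n ⊕ Fin m) K →ₐ[K] MvPowerSeries (Fin m) K :=
  MvPolynomial.aeval (Sum.elim w (MvPowerSeries.X : Fin m → MvPowerSeries (Fin m) K))

/-- The Jacobian matrix `Jac(P)` w.r.t. the `x` variables, evaluated at `(w, u)`. -/
noncomputable def jacAt {K : Type*} [Field K] {n m : ℕ}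
    (P : Fin n → MvPolynomial (Fin n ⊕ Fin m) K)
    (w : Fin n → MvPowerSeries (Fin m) K) :
    Matrix (Fin n) (Fin n) (MvPowerSeries (Fin m) K) :=
  Matrix.of fun i j => evalAt w (MvPolynomial.pderiv (Sum.inl j) (P i))

/-- One Newton step: `w' = w − Jac(P)(w,u)⁻¹ ⬝ (p_1(w,u), ..., p_n(w,u))ᵀ`. -/
noncomputable def newtonStep {K : Type*} [Field K] {n m : ℕ}
    (P : Fin n → MvPolynomial (Fin n ⊕ Fin m) K)
    (w : Fin n → MvPowerSeries (Fin m) K) :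
    Fin n → MvPowerSeries (Fin m) K :=
  fun j => w j - (jacAt P w)⁻¹.mulVec (fun i => evalAt w (P i)) j

/-- The maximal ideal `m = ⟨u_1, ..., u_m⟩` of `K[[u_1,...,u_m]]`. -/
noncomputable def mIdeal (K : Type*) [Field K] (m : ℕ) :
    Ideal (MvPowerSeries (Fin m) K) :=
  Ideal.span (Set.range (MvPowerSeries.X : Fin m → MvPowerSeries (Fin m) K))

/-- Polynomial evaluation respects congruence modulo an ideal. -/
theorem MvPolynomial.aeval_sub_aeval_mem {R S σ : Type*} [CommRing R] [CommRing S] [Algebra R S]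
    {I : Ideal S} {a b : σ → S} (h : ∀ i, a i - b i ∈ I) (p : MvPolynomial σ R) :
    aeval a p - aeval b p ∈ I := by
  induction p using MvPolynomial.induction_on with
  | C r => simp
  | add p q hp hq =>
    rw [map_add, map_add, add_sub_add_comm]
    exact I.add_mem hp hq
  | mul_X p i hp =>
    rw [map_mul, map_mul, aeval_X, aeval_X,
      show aeval a p * a i - aeval b p * b i =
        a i * (aeval a p - aeval b p) + aeval b p * (a i - b i) by ring]
    exact I.add_mem (I.mul_mem_left _ hp) (I.mul_mem_left _ (h i))

/-- First-order Taylor expansion of a multivariate polynomial, with remainder in the square of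
an ideal containing the increments. -/
theorem MvPolynomial.aeval_sub_aeval_sub_sum_pderiv_mem {R S σ : Type*} [CommRing R] [CommRing S]
    [Algebra R S] [Fintype σ] {I : Ideal S} {a b : σ → S} (h : ∀ i, a i - b i ∈ I)
    (p : MvPolynomial σ R) :
    aeval a p - aeval b p - ∑ i, aeval b (pderiv i p) * (a i - b i) ∈ I ^ 2 := by
  classical
  induction p using MvPolynomial.induction_on with
  | C r => simp
  | add p q hp hq =>
    convert (I ^ 2).add_mem hp hq using 1
    simp only [map_add, add_mul, Finset.sum_add_distrib]
    ring
  | mul_X p j hp =>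
    have hsum : ∑ i, aeval b (pderiv i (p * X j)) * (a i - b i) =
        b j * ∑ i, aeval b (pderiv i p) * (a i - b i) + aeval b p * (a j - b j) := by
      simp only [pderiv_mul, pderiv_X, Pi.single_apply, map_add, map_mul, aeval_X,
        apply_ite (aeval b), map_zero, add_mul, Finset.sum_add_distrib, mul_ite, mul_one,
        mul_zero, ite_mul, zero_mul, Finset.sum_ite_eq, Finset.mem_univ, if_true, Finset.mul_sum]
      congr 1
      exact Finset.sum_congr rfl fun i _ => by ring
    have hmul : (aeval a p - aeval b p) * (a j - b j) ∈ I ^ 2 := by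
      rw [pow_two]
      exact Ideal.mul_mem_mul (aeval_sub_aeval_mem h p) (h j)
    convert (I ^ 2).add_mem ((I ^ 2).mul_mem_left (b j) hp) hmul using 1
    rw [hsum, map_mul, map_mul, aeval_X, aeval_X]
    ring

theorem constantCoeff_eq_zero_of_mem_mIdeal {K : Type*} [Field K] {m : ℕ}
    {f : MvPowerSeries (Fin m) K} (hf : f ∈ mIdeal K m) :
    MvPowerSeries.constantCoeff f = 0 := by
  have hle : mIdeal K m ≤ RingHom.ker (MvPowerSeries.constantCoeff (σ := Fin m) (R := K)) := by
    rw [mIdeal, Ideal.span_le]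
    rintro _ ⟨i, rfl⟩
    simp
  exact hle hf

/-- Quadratic convergence of the Newton step: if `det Jac(P)(w,u)` is a unit and
`p_i(w,u) ∈ m^t` for all `i`, then for `w' = w − Jac(P)(w,u)⁻¹ ⬝ P(w,u)`:
(i) `w'_j − w_j ∈ m^t`; (ii) `p_i(w',u) ∈ m^{2t}`; (iii) `det Jac(P)(w',u)` is a unit. -/
theorem stmt_3 (K : Type*) [Field K] (n m : ℕ)
    (P : Fin n → MvPolynomial (Fin n ⊕ Fin m) K)
    (t : ℕ) (ht : 1 ≤ t)
    (w : Fin n → MvPowerSeries (Fin m) K)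
    (hdet : IsUnit (jacAt P w).det)
    (hmem : ∀ i, evalAt w (P i) ∈ (mIdeal K m) ^ t) :
    (∀ j, newtonStep P w j - w j ∈ (mIdeal K m) ^ t) ∧
    (∀ i, evalAt (newtonStep P w) (P i) ∈ (mIdeal K m) ^ (2 * t)) ∧
    IsUnit (jacAt P (newtonStep P w)).det := by
  have hstep : ∀ j, newtonStep P w j - w j ∈ (mIdeal K m) ^ t := by
    intro j
    rw [newtonStep, sub_sub_cancel_left]
    rw [neg_mem_iff, Matrix.mulVec_eq_sum, Finset.sum_apply]
    exact Ideal.sum_mem _ fun i _ => Ideal.mul_mem_left _ _ (hmem i)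
  have hdiff : ∀ s : Fin n ⊕ Fin m,
      Sum.elim (newtonStep P w) (MvPowerSeries.X : Fin m → MvPowerSeries (Fin m) K) s -
        Sum.elim w (MvPowerSeries.X : Fin m → MvPowerSeries (Fin m) K) s ∈ (mIdeal K m) ^ t := by
    rintro (j | k)
    · exact hstep j
    · simp
  refine ⟨hstep, fun i => ?_, ?_⟩
  · have hlin : (jacAt P w).mulVec (fun j => newtonStep P w j - w j) i = -evalAt w (P i) := by
      have hvec : (fun j => newtonStep P w j - w j) =
          -(jacAt P w)⁻¹.mulVec (fun i => evalAt w (P i)) := by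
        funext j
        simp [newtonStep]
      rw [hvec, Matrix.mulVec_neg, Matrix.mulVec_mulVec, Matrix.mul_nonsing_inv _ hdet,
        Matrix.one_mulVec, Pi.neg_apply]
    have htaylor := MvPolynomial.aeval_sub_aeval_sub_sum_pderiv_mem hdiff (P i)
    rw [← pow_mul, mul_comm t 2, Fintype.sum_sum_type] at htaylor
    simp only [Sum.elim_inl, Sum.elim_inr, sub_self, mul_zero, Finset.sum_const_zero,
      add_zero] at htaylor
    change evalAt (newtonStep P w) (P i) - evalAt w (P i) -
      (jacAt P w).mulVec (fun j => newtonStep P w j - w j) i ∈ _ at htaylor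
    rwa [hlin, sub_neg_eq_add, sub_add_cancel] at htaylor
  · rw [MvPowerSeries.isUnit_iff_constantCoeff, RingHom.map_det] at hdet ⊢
    convert hdet using 2
    ext i j
    refine sub_eq_zero.mp ((map_sub _ _ _).symm.trans (constantCoeff_eq_zero_of_mem_mIdeal ?_))
    exact Ideal.pow_le_self (Nat.one_le_iff_ne_zero.mp ht)
      (MvPolynomial.aeval_sub_aeval_mem hdiff _)
end

section
/- Let K be an algebraically closed field of characteristic zero and let p_1, ..., p_n be polynomials in K[x_1, ..., x_n]. Then there exists a nonzero polynomial s in K[z_1, ..., z_n] such that for every ρ = (ρ_1, ..., ρ_n) ∈ K^n with s(ρ) ≠ 0 and every α ∈ K^n satisfying p_i(α) = ρ_i for all i, the Jacobian matrix (∂p_i/∂x_j) evaluated at α is invertible. -/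
open TensorProduct in
/-- In characteristic zero, the differentials of algebraically independent elements of a finitely
generated field extension are linearly independent. -/
theorem AlgebraicIndependent.linearIndependent_D {K L ι : Type*} [Field K] [CharZero K] [Field L]
    [Algebra K L] [Algebra.EssFiniteType K L] {v : ι → L} (hv : AlgebraicIndependent K v) :
    LinearIndependent L fun i => KaehlerDifferential.D K L (v i) := by
  let S := MvPolynomial ι K
  let M := FractionRing S
  let : Algebra S L := (MvPolynomial.aeval v : S →ₐ[K] L).toAlgebra
  have : IsScalarTower K S L := .of_algebraMap_eq fun x => (MvPolynomial.aeval_C v x).symm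
  have : FaithfulSMul S L := (faithfulSMul_iff_algebraMap_injective S L).mpr hv
  let : Algebra M L := FractionRing.liftAlgebra S L
  have : IsScalarTower K M L := .to₁₃₄ K S M L
  have : CharZero M := charZero_of_injective_algebraMap (algebraMap K M).injective
  have : Algebra.EssFiniteType M L := .of_comp K M L
  have : Algebra.FormallySmooth S M := .of_isLocalization (nonZeroDivisors S)
  have : Algebra.FormallySmooth S L := .comp S M L
  have hinj : Function.Injective (KaehlerDifferential.mapBaseChange K S L) := by
    rw [injective_iff_map_eq_zero]
    intro x hx
    obtain ⟨x, rfl⟩ := (Algebra.H1Cotangent.exact_δ_mapBaseChange K S L x).mp hx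
    rw [Subsingleton.elim x 0, map_zero]
  have hb := (((KaehlerDifferential.mvPolynomialBasis K ι).baseChange L).linearIndependent).map'
    (KaehlerDifferential.mapBaseChange K S L) (LinearMap.ker_eq_bot.mpr hinj)
  refine (funext fun i => ?_ : _ = fun i => KaehlerDifferential.D K L (v i)) ▸ hb
  simp [KaehlerDifferential.mvPolynomialBasis_apply, S, RingHom.algebraMap_toAlgebra]

/-- The chain rule for a derivation applied to a polynomial expression. -/
theorem Derivation.map_mvPolynomial_aeval {R A M σ : Type*} [CommRing R] [CommRing A]
    [Algebra R A] [AddCommGroup M] [Module A M] [Module R M] [Fintype σ]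
    (D : Derivation R A M) (x : σ → A) (p : MvPolynomial σ R) :
    D (MvPolynomial.aeval x p) =
      ∑ j, MvPolynomial.aeval x (MvPolynomial.pderiv j p) • D (x j) := by
  classical
  induction p using MvPolynomial.induction_on with
  | C a => simp
  | add p q hp hq => simp [hp, hq, add_smul, Finset.sum_add_distrib]
  | mul_X p i hp =>
    simp [hp, Derivation.leibniz, add_smul, Finset.sum_add_distrib, Finset.smul_sum, mul_smul,
      MvPolynomial.pderiv_X, Pi.single_apply, apply_ite, ite_smul]

open MvPolynomial in
/-- Jacobian criterion in characteristic zero: if polynomial expressions `p i` in elements `x j` of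
a finitely generated field extension are algebraically independent, then the Jacobian determinant
of `p` does not vanish at `x`. -/
theorem AlgebraicIndependent.det_aeval_pderiv_ne_zero {K L ι : Type*} [Field K] [CharZero K]
    [Field L] [Algebra K L] [Algebra.EssFiniteType K L] [Fintype ι] [DecidableEq ι] (x : ι → L)
    (p : ι → MvPolynomial ι K) (h : AlgebraicIndependent K fun i => aeval x (p i)) :
    (Matrix.of fun i j => aeval x (pderiv j (p i))).det ≠ 0 := by
  intro hdet
  obtain ⟨w, hw, hw0⟩ := Matrix.exists_vecMul_eq_zero_iff.mpr hdet
  refine hw (funext (Fintype.linearIndependent_iff.mp h.linearIndependent_D w ?_))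
  simp_rw [Derivation.map_mvPolynomial_aeval, Finset.smul_sum, smul_smul]
  rw [Finset.sum_comm]
  refine Finset.sum_eq_zero fun j _ => ?_
  rw [← Finset.sum_smul]
  have : ∑ i, w i * aeval x (pderiv j (p i)) = 0 := congrFun hw0 j
  rw [this, zero_smul]

open MvPolynomial in
/-- In characteristic zero, the Jacobian determinant of `p` divides `s(p)` for some
nonzero polynomial `s`. -/
theorem MvPolynomial.exists_det_pderiv_dvd_aeval {K ι : Type*} [Field K] [CharZero K]
    [Fintype ι] [DecidableEq ι] (p : ι → MvPolynomial ι K) :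
    ∃ s : MvPolynomial ι K, s ≠ 0 ∧
      (Matrix.of fun i j => pderiv j (p i)).det ∣ aeval p s := by
  by_contra! hs
  set J := (Matrix.of fun i j => pderiv j (p i)).det with hJ
  let S := (nonZeroDivisors (MvPolynomial ι K)).map (aeval p : _ →ₐ[K] MvPolynomial ι K)
  obtain ⟨Q, hQ, hJQ, hQS⟩ := Ideal.exists_le_prime_disjoint (Ideal.span {J}) S <| by
    rw [Set.disjoint_left]
    rintro _ hf ⟨s, hs0, rfl⟩
    exact hs s (nonZeroDivisors.ne_zero hs0) (Ideal.mem_span_singleton.mp hf)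
  let B := MvPolynomial ι K ⧸ Q
  let L := FractionRing B
  have : Algebra.EssFiniteType B L := .of_isLocalization _ (nonZeroDivisors B)
  have : Algebra.EssFiniteType K L := .comp K B L
  let φ : MvPolynomial ι K →ₐ[K] L := (IsScalarTower.toAlgHom K B L).comp (Ideal.Quotient.mkₐ K Q)
  have hφ (f) : φ f = 0 ↔ f ∈ Q := by
    simp [φ, L, B, Ideal.Quotient.eq_zero_iff_mem]
  have hφx (f) : aeval (fun i => φ (X i)) f = φ f :=
    (DFunLike.congr_fun (aeval_unique φ) f).symm
  refine AlgebraicIndependent.det_aeval_pderiv_ne_zero (fun i => φ (X i)) p ?_ ?_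
  · simp_rw [hφx, algebraicIndependent_iff]
    intro s hs0
    by_contra hne
    refine Set.disjoint_left.mp hQS ((hφ (aeval p s)).mp ?_)
      ⟨s, mem_nonZeroDivisors_of_ne_zero hne, rfl⟩
    rw [← hs0, ← comp_aeval_apply]
  · simp_rw [hφx]
    have : φ J = 0 := (hφ J).mpr (hJQ (Ideal.mem_span_singleton_self J))
    rwa [hJ, AlgHom.map_det] at this


/-- Generic regularity of fibers: for polynomials p_1, ..., p_n over an algebraically
closed field K of characteristic zero, there is a nonzero polynomial s in K[z_1,...,z_n]
such that for every ρ with s(ρ) ≠ 0 and every α with p_i(α) = ρ_i for all i, the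
Jacobian matrix (∂p_i/∂x_j) is invertible at α. -/
theorem stmt_7 (K : Type*) [Field K] [IsAlgClosed K] [CharZero K] (n : ℕ)
    (p : Fin n → MvPolynomial (Fin n) K) :
    ∃ s : MvPolynomial (Fin n) K, s ≠ 0 ∧
      ∀ ρ : Fin n → K, MvPolynomial.eval ρ s ≠ 0 →
        ∀ α : Fin n → K, (∀ i, MvPolynomial.eval α (p i) = ρ i) →
          IsUnit (Matrix.det (Matrix.of fun i j : Fin n =>
            MvPolynomial.eval α (MvPolynomial.pderiv j (p i)))) := by
  obtain ⟨s, hs, hdvd⟩ := MvPolynomial.exists_det_pderiv_dvd_aeval p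
  refine ⟨s, hs, fun ρ hρ α hα => isUnit_iff_ne_zero.mpr fun hdet => hρ ?_⟩
  obtain rfl : (fun i => MvPolynomial.eval α (p i)) = ρ := funext hα
  have hcomp : MvPolynomial.eval α (MvPolynomial.aeval p s) =
      MvPolynomial.eval (fun i => MvPolynomial.eval α (p i)) s := by
    simpa [MvPolynomial.coe_aeval_eq_eval] using
      MvPolynomial.comp_aeval_apply p (MvPolynomial.aeval α) s
  rw [← hcomp, ← zero_dvd_iff]
  convert map_dvd (MvPolynomial.eval α) hdvd
  rw [RingHom.map_det]
  exact hdet.symm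
end

section
/- Let K be an algebraically closed field of characteristic zero and let p_1, ..., p_n be polynomials in K[x_1, ..., x_n] that are algebraically independent over K. Then there exists a nonzero polynomial r in K[x_1, ..., x_n] such that for every α ∈ K^n with r(α) ≠ 0, the point α is a common zero of the shifted system Q = (p_1 − p_1(α), ..., p_n − p_n(α)) and the Jacobian matrix of Q with respect to x_1, ..., x_n evaluated at α is invertible. -/
/-- A derivation of a domain of characteristic zero, linear over a subring, vanishes at every
element algebraic over that subring. -/
theorem Derivation.eq_zero_of_isAlgebraic {A R : Type*} [CommRing A] [CommRing R] [IsDomain R]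
    [CharZero R] [Algebra A R] [FaithfulSMul A R] (D : Derivation A R R) {x : R}
    (hx : IsAlgebraic A x) : D x = 0 := by
  have inj : Function.Injective (algebraMap A R) := FaithfulSMul.algebraMap_injective A R
  have : IsDomain A := inj.isDomain
  have : CharZero A :=
    ⟨fun m n h => by simpa using congrArg (algebraMap A R) h⟩
  obtain ⟨f, hf, hfx⟩ := hx
  induction hm : f.natDegree using Nat.strong_induction_on generalizing f with
  | _ m ih =>
    have hdeg : f.natDegree ≠ 0 := by
      intro h0
      rw [Polynomial.eq_C_of_natDegree_eq_zero h0, Polynomial.aeval_C,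
        map_eq_zero_iff _ inj] at hfx
      rw [Polynomial.eq_C_of_natDegree_eq_zero h0, hfx, map_zero] at hf
      exact hf rfl
    have hmul : Polynomial.aeval x f.derivative * D x = 0 := by
      rw [← smul_eq_mul, ← D.map_aeval, hfx, map_zero]
    rcases mul_eq_zero.mp hmul with h | h
    · exact ih _ (hm ▸ Polynomial.natDegree_derivative_lt hdeg) f.derivative
        (fun h0 => hdeg (Polynomial.derivative_eq_zero.mp h0)) h rfl
    · exact h

/-- A derivation vanishing on a set is linear over the subalgebra generated by that set. -/
def Derivation.extendScalarsAdjoin {K R : Type*} [CommRing K] [CommRing R] [Algebra K R]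
    (D : Derivation K R R) (s : Set R) (hs : Set.EqOn D (0 : Derivation K R R) s) :
    Derivation (Algebra.adjoin K s) R R where
  toFun := D
  map_add' := map_add D
  map_smul' a y := by
    have ha : D a = 0 := Derivation.eqOn_adjoin hs a.2
    simp [Algebra.smul_def, ha]
  map_one_eq_zero' := D.map_one_eq_zero
  leibniz' := D.leibniz

/-- The Jacobian criterion: in characteristic zero the Jacobian determinant of algebraically
independent polynomials, as many as there are variables, does not vanish identically. -/
theorem AlgebraicIndependent.det_pderiv_ne_zero {K ι : Type*} [Field K] [CharZero K] [Fintype ι]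
    [DecidableEq ι] {p : ι → MvPolynomial ι K} (hp : AlgebraicIndependent K p) :
    (Matrix.of fun i j => MvPolynomial.pderiv j (p i)).det ≠ 0 := by
  intro hdet
  obtain ⟨v, hv, hJv⟩ := Matrix.exists_mulVec_eq_zero_iff.mpr hdet
  let D : Derivation K (MvPolynomial ι K) (MvPolynomial ι K) := MvPolynomial.mkDerivation K v
  have hD (f : MvPolynomial ι K) : D f = ∑ j, v j * MvPolynomial.pderiv j f := by
    have hsum : D = ∑ j, v j • MvPolynomial.pderiv j := by
      refine MvPolynomial.derivation_ext fun i => ?_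
      rw [← Derivation.coeFnAddMonoidHom_apply (∑ j, _), map_sum, Finset.sum_apply]
      simp [D, MvPolynomial.mkDerivation_X, MvPolynomial.pderiv_X, Pi.single_apply]
    rw [hsum, ← Derivation.coeFnAddMonoidHom_apply, map_sum, Finset.sum_apply]
    simp
  have hDp : Set.EqOn D (0 : Derivation K (MvPolynomial ι K) (MvPolynomial ι K))
      (Set.range p) := by
    rintro _ ⟨i, rfl⟩
    simpa [hD, Matrix.mulVec, dotProduct, mul_comm] using congrFun hJv i
  have hbasis : IsTranscendenceBasis K p :=
    isTranscendenceBasis_of_lift_trdeg_le_of_finite hp (by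
      rw [MvPolynomial.trdeg_of_isDomain]; simp)
  have halg := hbasis.isAlgebraic
  refine hv (funext fun j => ?_)
  have hXj := (D.extendScalarsAdjoin _ hDp).eq_zero_of_isAlgebraic
    (halg.isAlgebraic (MvPolynomial.X j))
  exact (MvPolynomial.mkDerivation_X K v j).symm.trans hXj

/-- For algebraically independent polynomials p_1, ..., p_n over an algebraically
closed field K of characteristic zero, there is a nonzero polynomial r such that for
every α with r(α) ≠ 0, the point α is a common zero of the shifted system
Q = (p_1 − p_1(α), ..., p_n − p_n(α)) and the Jacobian matrix of Q evaluated at α is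
invertible. -/
theorem stmt_8 (K : Type*) [Field K] [IsAlgClosed K] [CharZero K] (n : ℕ)
    (p : Fin n → MvPolynomial (Fin n) K)
    (hp : AlgebraicIndependent K p) :
    ∃ r : MvPolynomial (Fin n) K, r ≠ 0 ∧
      ∀ α : Fin n → K, MvPolynomial.eval α r ≠ 0 →
        (∀ i, MvPolynomial.eval α
            (p i - MvPolynomial.C (MvPolynomial.eval α (p i))) = 0) ∧
        IsUnit (Matrix.det (Matrix.of fun i j : Fin n =>
          MvPolynomial.eval α (MvPolynomial.pderiv j
            (p i - MvPolynomial.C (MvPolynomial.eval α (p i)))))) := by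
  refine ⟨_, hp.det_pderiv_ne_zero, fun α hα => ⟨fun i => by simp, ?_⟩⟩
  rw [RingHom.map_det] at hα
  simpa [RingHom.mapMatrix_apply, Matrix.map] using hα
end

section
/- Let K be a field, let W = (w_1, ..., w_n) be a tuple of positive integers, and let g_1, ..., g_n in K[x_1, ..., x_n] be algebraically independent polynomials over K such that each g_i is W-homogeneous of W-degree d_i. Let f in K[u_1, ..., u_n] be nonzero and set h = f(g_1, ..., g_n). Then deg_W(h) = deg_{W'}(f), where W' = (d_1, ..., d_n). -/
namespace MvPolynomial

variable {R σ τ M : Type*} [CommSemiring R] [AddCommMonoid M]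

/-- Substituting weighted homogeneous polynomials into a monomial gives a weighted homogeneous
polynomial. -/
theorem isWeightedHomogeneous_aeval_monomial {w : τ → M} {d : σ → M} {g : σ → MvPolynomial τ R}
    (hg : ∀ i, IsWeightedHomogeneous w (g i) (d i)) (s : σ →₀ ℕ) (r : R) :
    IsWeightedHomogeneous w (aeval g (monomial s r)) (Finsupp.weight d s) := by
  rw [aeval_monomial, algebraMap_eq, Finsupp.weight_apply]
  exact (IsWeightedHomogeneous.prod s.support _ _ fun i _ => (hg i).pow (s i)).C_mul r

/-- Substituting weighted homogeneous polynomials commutes with taking weighted homogeneous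
components. -/
theorem weightedHomogeneousComponent_aeval {w : τ → M} {d : σ → M} {g : σ → MvPolynomial τ R}
    (hg : ∀ i, IsWeightedHomogeneous w (g i) (d i)) (m : M) (f : MvPolynomial σ R) :
    weightedHomogeneousComponent w m (aeval g f) =
      aeval g (weightedHomogeneousComponent d m f) := by
  classical
  induction f using MvPolynomial.induction_on' with
  | monomial s r =>
    rw [weightedHomogeneousComponent_of_mem (isWeightedHomogeneous_aeval_monomial hg s r),
      weightedHomogeneousComponent_of_mem (isWeightedHomogeneous_monomial d s r rfl)]
    split_ifs <;> simp
  | add p q hp hq => simp only [map_add, hp, hq]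

theorem weightedTotalDegree_le_iff_weightedHomogeneousComponent_eq_zero (w : σ → ℕ)
    (p : MvPolynomial σ R) (N : ℕ) :
    weightedTotalDegree w p ≤ N ↔ ∀ m, N < m → weightedHomogeneousComponent w m p = 0 := by
  classical
  refine ⟨fun h m hm => weightedHomogeneousComponent_eq_zero m p (h.trans_lt hm), fun h => ?_⟩
  refine Finset.sup_le fun s hs => ?_
  by_contra! hlt
  have hcoeff := congrArg (coeff s) (h _ hlt)
  rw [coeff_weightedHomogeneousComponent, if_pos rfl, coeff_zero] at hcoeff
  exact mem_support_iff.mp hs hcoeff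

end MvPolynomial

/-- For algebraically independent W-homogeneous polynomials g_i of W-degrees d_i
and a nonzero polynomial f, the W-degree of h = f(g_1, ..., g_n) equals the
W'-degree of f, where W' = (d_1, ..., d_n). -/
theorem stmt_12 (K : Type*) [Field K] (n : ℕ)
    (W : Fin n → ℕ) (hW : ∀ i, 0 < W i)
    (g : Fin n → MvPolynomial (Fin n) K)
    (hg : AlgebraicIndependent K g)
    (d : Fin n → ℕ)
    (hgh : ∀ i, MvPolynomial.IsWeightedHomogeneous W (g i) (d i))
    (f : MvPolynomial (Fin n) K) (hf : f ≠ 0)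
    (h : MvPolynomial (Fin n) K)
    (hh : h = MvPolynomial.aeval g f) :
    MvPolynomial.weightedTotalDegree W h = MvPolynomial.weightedTotalDegree d f := by
  subst hh
  refine eq_of_forall_ge_iff fun N => ?_
  simp only [MvPolynomial.weightedTotalDegree_le_iff_weightedHomogeneousComponent_eq_zero,
    MvPolynomial.weightedHomogeneousComponent_aeval hgh,
    map_eq_zero_iff (MvPolynomial.aeval g) hg]
end

section
/- Let K be a field and let g_1, ..., g_n in K[x_1, ..., x_n] be algebraically independent polynomials over K, with each g_i homogeneous (for the standard grading) of degree d_i ≥ 1. Let f in K[u_1, ..., u_n] be nonzero and set h = f(g_1, ..., g_n). Then the weighted total degree of f with respect to the weights W' = (d_1, ..., d_n) equals the total degree of h; as a consequence, the total degree of f is at most the total degree of h. -/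
namespace MvPolynomial

variable {σ τ R : Type*} [CommSemiring R]

theorem isHomogeneous_aeval_monomial {g : σ → MvPolynomial τ R} {d : σ → ℕ}
    (hg : ∀ i, (g i).IsHomogeneous (d i)) (s : σ →₀ ℕ) (a : R) :
    (aeval g (monomial s a)).IsHomogeneous (Finsupp.weight d s) := by
  rw [aeval_monomial, Finsupp.weight_apply, algebraMap_eq]
  refine IsHomogeneous.C_mul (IsHomogeneous.prod _ _ _ fun i _ => ?_) a
  simpa [mul_comm] using (hg i).pow (s i)

/-- Substituting homogeneous polynomials of degrees `d i` for the variables turns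
`d`-weighted homogeneous components into homogeneous components. -/
theorem homogeneousComponent_aeval {g : σ → MvPolynomial τ R} {d : σ → ℕ}
    (hg : ∀ i, (g i).IsHomogeneous (d i)) (m : ℕ) (f : MvPolynomial σ R) :
    homogeneousComponent m (aeval g f) = aeval g (weightedHomogeneousComponent d m f) := by
  induction f using MvPolynomial.induction_on' with
  | monomial s a =>
    rw [homogeneousComponent_of_mem (isHomogeneous_aeval_monomial hg s a),
      weightedHomogeneousComponent_of_mem (isWeightedHomogeneous_monomial d s a rfl),
      apply_ite (aeval g), map_zero]
  | add p q hp hq => simp only [map_add, hp, hq]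

theorem totalDegree_le_weightedTotalDegree {d : σ → ℕ} (hd : ∀ i, 1 ≤ d i)
    (f : MvPolynomial σ R) : f.totalDegree ≤ weightedTotalDegree d f := by
  refine Finset.sup_le fun s hs => le_trans ?_ (le_weightedTotalDegree d hs)
  rw [Finsupp.weight_apply]
  exact Finset.sum_le_sum fun i _ => Nat.le_mul_of_pos_right _ (hd i)

theorem weightedHomogeneousComponent_weightedTotalDegree_ne_zero (d : σ → ℕ)
    {f : MvPolynomial σ R} (hf : f ≠ 0) :
    weightedHomogeneousComponent d (weightedTotalDegree d f) f ≠ 0 := by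
  obtain ⟨s, hs, hsd⟩ := Finset.exists_mem_eq_sup f.support (support_nonempty.2 hf)
    (Finsupp.weight d)
  refine ne_zero_iff.2 ⟨s, ?_⟩
  rw [coeff_weightedHomogeneousComponent, weightedTotalDegree, if_pos hsd.symm]
  exact mem_support_iff.1 hs

theorem totalDegree_aeval_le_weightedTotalDegree {g : σ → MvPolynomial τ R} {d : σ → ℕ}
    (hg : ∀ i, (g i).IsHomogeneous (d i)) (f : MvPolynomial σ R) :
    (aeval g f).totalDegree ≤ weightedTotalDegree d f := by
  refine Finset.sup_le fun s hs => ?_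
  change s.degree ≤ _
  by_contra! hlt
  refine mem_support_iff.1 hs ?_
  have hcoeff := coeff_homogeneousComponent s.degree (aeval g f) s
  rw [if_pos rfl] at hcoeff
  rw [← hcoeff, homogeneousComponent_aeval hg,
    weightedHomogeneousComponent_eq_zero _ _ hlt, map_zero, coeff_zero]

theorem totalDegree_aeval_eq_weightedTotalDegree {R : Type*} [CommRing R]
    {g : σ → MvPolynomial τ R} (hgi : AlgebraicIndependent R g) {d : σ → ℕ}
    (hg : ∀ i, (g i).IsHomogeneous (d i)) {f : MvPolynomial σ R} (hf : f ≠ 0) :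
    (aeval g f).totalDegree = weightedTotalDegree d f := by
  refine (totalDegree_aeval_le_weightedTotalDegree hg f).antisymm ?_
  by_contra! hlt
  have hzero := homogeneousComponent_eq_zero _ _ hlt
  rw [homogeneousComponent_aeval hg] at hzero
  exact weightedHomogeneousComponent_weightedTotalDegree_ne_zero d hf
    (hgi.eq_zero_of_aeval_eq_zero _ hzero)

end MvPolynomial

/-- For algebraically independent polynomials g_i, homogeneous of degrees d_i ≥ 1
for the standard grading, and a nonzero polynomial f with h = f(g_1, ..., g_n), the
weighted total degree of f with respect to W' = (d_1, ..., d_n) equals the total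
degree of h; consequently the total degree of f is at most the total degree of h. -/
theorem stmt_14 (K : Type*) [Field K] (n : ℕ)
    (g : Fin n → MvPolynomial (Fin n) K)
    (hg : AlgebraicIndependent K g)
    (d : Fin n → ℕ) (hd : ∀ i, 1 ≤ d i)
    (hgh : ∀ i, MvPolynomial.IsHomogeneous (g i) (d i))
    (f : MvPolynomial (Fin n) K) (hf : f ≠ 0)
    (h : MvPolynomial (Fin n) K)
    (hh : h = MvPolynomial.aeval g f) :
    MvPolynomial.weightedTotalDegree d f = MvPolynomial.totalDegree h ∧
      MvPolynomial.totalDegree f ≤ MvPolynomial.totalDegree h := by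
  subst hh
  have heq := MvPolynomial.totalDegree_aeval_eq_weightedTotalDegree hg hgh hf
  exact ⟨heq.symm, heq ▸ MvPolynomial.totalDegree_le_weightedTotalDegree hd f⟩
end

section
/- Let K be a commutative ring, R a commutative K-algebra, p a polynomial in K[x_1, ..., x_n], and a = (a_1, ..., a_n), b = (b_1, ..., b_n) elements of R^n. Then p(b) − p(a) − Σ_{j=1}^n (∂p/∂x_j)(a) · (b_j − a_j) belongs to I², where I is the ideal of R generated by b_1 − a_1, ..., b_n − a_n. -/
/-- First-order Taylor expansion: for a polynomial p ∈ K[x_1,...,x_n] and points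
a, b ∈ Rⁿ in a commutative K-algebra R, the difference
p(b) − p(a) − Σ_j (∂p/∂x_j)(a)·(b_j − a_j) lies in I², where I is the ideal of R
generated by b_1 − a_1, ..., b_n − a_n. -/
theorem stmt_15 (K : Type*) [CommRing K] (R : Type*) [CommRing R] [Algebra K R]
    (n : ℕ) (p : MvPolynomial (Fin n) K) (a b : Fin n → R) :
    MvPolynomial.aeval b p - MvPolynomial.aeval a p -
        ∑ j : Fin n, MvPolynomial.aeval a (MvPolynomial.pderiv j p) * (b j - a j) ∈
      (Ideal.span (Set.range fun j => b j - a j)) ^ 2 := by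
  set I := Ideal.span (Set.range fun j => b j - a j)
  have hmem : ∀ j, b j - a j ∈ I := fun j => Ideal.subset_span ⟨j, rfl⟩
  induction p using MvPolynomial.induction_on with
  | C r => simp
  | add p q hp hq =>
    convert add_mem hp hq using 1
    simp only [map_add, add_mul, Finset.sum_add_distrib]
    ring
  | mul_X p i hp =>
    have hsum : ∑ j, MvPolynomial.aeval a (MvPolynomial.pderiv j p) * (b j - a j) ∈ I :=
      sum_mem fun j _ => I.mul_mem_left _ (hmem j)
    have hsub : MvPolynomial.aeval b p - MvPolynomial.aeval a p ∈ I := by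
      simpa using add_mem (Ideal.pow_le_self two_ne_zero hp) hsum
    have hprod : (MvPolynomial.aeval b p - MvPolynomial.aeval a p) * (b i - a i) ∈ I ^ 2 := by
      rw [pow_two]
      exact Ideal.mul_mem_mul hsub (hmem i)
    have hderiv : ∑ j, MvPolynomial.aeval a (MvPolynomial.pderiv j (p * MvPolynomial.X i)) *
          (b j - a j) =
        a i * ∑ j, MvPolynomial.aeval a (MvPolynomial.pderiv j p) * (b j - a j) +
          MvPolynomial.aeval a p * (b i - a i) := by
      have hterm : ∀ j, MvPolynomial.aeval a (MvPolynomial.pderiv j (p * MvPolynomial.X i)) *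
            (b j - a j) =
          a i * (MvPolynomial.aeval a (MvPolynomial.pderiv j p) * (b j - a j)) +
            if j = i then MvPolynomial.aeval a p * (b i - a i) else 0 := by
        intro j
        rw [MvPolynomial.pderiv_mul]
        by_cases h : j = i
        · subst h
          simp
          ring
        · simp [h, MvPolynomial.pderiv_X_of_ne (Ne.symm h)]
          ring
      simp only [hterm, Finset.sum_add_distrib, Finset.mul_sum, Finset.sum_ite_eq', Finset.mem_univ,
        if_true]
    rw [hderiv]
    convert add_mem ((I ^ 2).mul_mem_left (a i) hp) hprod using 1
    simp only [map_mul, MvPolynomial.aeval_X]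
    ring
end
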